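/- Let C and C′ be Clifford unitaries on n qubits. Then the Clifford tableau of the concatenated circuit satisfies T(C′·C) = T(C) ⊛ T(C′), where the right-hand side is the row-wise ⊛-product of tableaus; note the reversal of order relative to the composition of unitaries. -/

import Mathlib

open Matrix

abbrev GG (n : ℕ) := ZMod 4 × (Fin n → ZMod 2) × (Fin n → ZMod 2)

def dotF2 {n : ℕ} (a b : Fin n → ZMod 2) : ZMod 2 := ∑ j, a j * b j

def lift24 (x : ZMod 2) : ZMod 4 := (x.val : ZMod 4)

def gop {n : ℕ} (p q : GG n) : GG n :=
  (p.1 + q.1 + 2 * lift24 (dotF2 p.2.2 q.2.1), p.2.1 + q.2.1, p.2.2 + q.2.2)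

abbrev PMat (n : ℕ) := Matrix (Fin n → ZMod 2) (Fin n → ZMod 2) ℂ

noncomputable def PauliOp {n : ℕ} (ε : ZMod 4) (ξ ζ : Fin n → ZMod 2) : PMat n :=
  fun u v => Complex.I ^ ε.val * (-1 : ℂ) ^ (dotF2 ζ v).val * (if u = v + ξ then 1 else 0)

def eVec {n : ℕ} (t : Fin n) : Fin n → ZMod 2 := fun j => if j = t then 1 else 0

/-- A Clifford unitary: a unitary matrix normalizing the Pauli group
(under right conjugation C† P C). -/
def IsCliffordUnitary {n : ℕ} (C : PMat n) : Prop :=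
  C * Cᴴ = 1 ∧ Cᴴ * C = 1 ∧
  ∀ p : GG n, ∃ q : GG n, Cᴴ * PauliOp p.1 p.2.1 p.2.2 * C = PauliOp q.1 q.2.1 q.2.2

/-- The generators g₀ = iI, g_j = P(0,e_j,0) (1 ≤ j ≤ n), g_{n+j} = P(0,0,e_j). -/
noncomputable def gens (n : ℕ) (i : Fin (2 * n + 1)) : PMat n :=
  if _h0 : i.val = 0 then Complex.I • (1 : PMat n)
  else if h1 : i.val ≤ n then PauliOp 0 (eVec ⟨i.val - 1, by have := i.isLt; omega⟩) 0
  else PauliOp 0 0 (eVec ⟨i.val - 1 - n, by have := i.isLt; omega⟩)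

/-- M is the flow tableau of C: row i presents C† gᵢ C, i.e. ρ(C† gᵢ C) = Mᵢ. -/
def IsFlowTableau {n : ℕ} (C : PMat n) (M : Fin (2 * n + 1) → GG n) : Prop :=
  ∀ i, PauliOp (M i).1 (M i).2.1 (M i).2.2 = Cᴴ * gens n i * C

/-- M is the Clifford tableau of C: row i presents C gᵢ C†, i.e. ρ(C gᵢ C†) = Mᵢ. -/
def IsCliffordTableau {n : ℕ} (C : PMat n) (M : Fin (2 * n + 1) → GG n) : Prop :=
  ∀ i, PauliOp (M i).1 (M i).2.1 (M i).2.2 = C * gens n i * Cᴴ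

/-- Row index 1,…,2n of a tableau, indexed by Fin n ⊕ Fin n. -/
def rowIdx (n : ℕ) : Fin n ⊕ Fin n → Fin (2 * n + 1)
  | .inl j => ⟨j.val + 1, by have := j.isLt; omega⟩
  | .inr j => ⟨n + j.val + 1, by have := j.isLt; omega⟩

/-- The phaseless 2n×2n block of a tableau over 𝔽₂: row i is (ξᵢ | ζᵢ). -/
def tabBlock {n : ℕ} (M : Fin (2 * n + 1) → GG n) :
    Matrix (Fin n ⊕ Fin n) (Fin n ⊕ Fin n) (ZMod 2) :=
  fun i => Sum.elim (M (rowIdx n i)).2.1 (M (rowIdx n i)).2.2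

/-- Ω = ((0,I),(I,0)). -/
def Ωblk (n : ℕ) : Matrix (Fin n ⊕ Fin n) (Fin n ⊕ Fin n) (ZMod 2) :=
  Matrix.fromBlocks 0 1 1 0

/-- The i-th bit (1 ≤ i ≤ 2n) of the phaseless part of ϱ ∈ Gₙ. -/
def bitOf {n : ℕ} (ϱ : GG n) (i : Fin (2 * n)) : ZMod 2 :=
  if h : i.val < n then ϱ.2.1 ⟨i.val, h⟩
  else ϱ.2.2 ⟨i.val - n, by have := i.isLt; omega⟩

/-- The vector–tableau product ϱ ⊛ M := (ϱ₀·ε₀|0|0) ⊛ m_{i₁} ⊛ ⋯ ⊛ m_{i_k}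
over the indices i ≥ 1 with ϱᵢ = 1, in increasing order. -/
def starVecMul {n : ℕ} (ϱ : GG n) (M : Fin (2 * n + 1) → GG n) : GG n :=
  (((List.finRange (2 * n)).filter (fun i => decide (bitOf ϱ i = 1))).map
    (fun i => M i.succ)).foldl gop (ϱ.1 * (M 0).1, 0, 0)

/-- The Pauli operator of a phase-space element. -/
noncomputable def pauliMat {n : ℕ} (p : GG n) : PMat n := PauliOp p.1 p.2.1 p.2.2

lemma I_pow_val_add (a b : ZMod 4) :
    Complex.I ^ (a + b).val = Complex.I ^ a.val * Complex.I ^ b.val := by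
  rw [ZMod.val_add, ← Complex.I_pow_eq_pow_mod, pow_add]

lemma neg_one_pow_val_add (a b : ZMod 2) :
    (-1 : ℂ) ^ (a + b).val = (-1) ^ a.val * (-1) ^ b.val := by
  rw [ZMod.val_add, ← neg_one_pow_eq_pow_mod_two, pow_add]

lemma I_pow_val_two_mul_lift24 (x : ZMod 2) :
    Complex.I ^ (2 * lift24 x).val = (-1 : ℂ) ^ x.val := by
  have hx : (2 * lift24 x).val = 2 * x.val := by
    revert x
    decide
  rw [hx, pow_mul, Complex.I_sq]

lemma I_pow_val_injective : Function.Injective fun a : ZMod 4 => Complex.I ^ a.val := by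
  intro a b h
  have h_one : ∀ c : ZMod 4, Complex.I ^ c.val = 1 → c = 0 := by
    intro c hc
    fin_cases c
    · rfl
    · have := congrArg Complex.im (show Complex.I ^ 1 = 1 from hc)
      simp at this
    · have := congrArg Complex.re (show Complex.I ^ 2 = 1 from hc)
      norm_num [Complex.I_sq] at this
    · have := congrArg Complex.im (show Complex.I ^ 3 = 1 from hc)
      simp [Complex.I_pow_three] at this
  have hab : Complex.I ^ (a - b).val * Complex.I ^ b.val = 1 * Complex.I ^ b.val := by
    rw [← I_pow_val_add, sub_add_cancel, one_mul]
    exact h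
  exact sub_eq_zero.mp (h_one _ (mul_right_cancel₀ (pow_ne_zero _ Complex.I_ne_zero) hab))

lemma neg_one_pow_val_injective : Function.Injective fun a : ZMod 2 => (-1 : ℂ) ^ a.val := by
  intro a b h
  have h_two : Function.Injective fun x : ZMod 2 => 2 * lift24 x := by decide
  apply h_two
  apply I_pow_val_injective
  simpa only [I_pow_val_two_mul_lift24] using h

lemma dotF2_eq_dotProduct {n : ℕ} (a b : Fin n → ZMod 2) : dotF2 a b = a ⬝ᵥ b := rfl

lemma dotF2_eVec {n : ℕ} (a : Fin n → ZMod 2) (t : Fin n) : dotF2 a (eVec t) = a t := by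
  simp [dotF2, eVec]

lemma pauliMat_mul {n : ℕ} (p q : GG n) :
    pauliMat p * pauliMat q = pauliMat (gop p q) := by
  ext u w
  rw [Matrix.mul_apply, Finset.sum_eq_single (w + q.2.1)]
  · have hw : w + q.2.1 + p.2.1 = w + (p.2.1 + q.2.1) := by abel
    simp only [pauliMat, PauliOp, gop, I_pow_val_add, I_pow_val_two_mul_lift24,
      dotF2_eq_dotProduct, dotProduct_add, add_dotProduct, neg_one_pow_val_add, hw, if_true]
    ring_nf
  · intro v _ hv
    simp [pauliMat, PauliOp, hv]
  · simp

lemma pauliMat_injective {n : ℕ} : Function.Injective (pauliMat (n := n)) := by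
  rintro ⟨ε, ξ, ζ⟩ ⟨ε', ξ', ζ'⟩ h
  have h_entry (u v) := congrFun (congrFun h u) v
  simp only [pauliMat, PauliOp] at h_entry
  obtain rfl : ξ = ξ' := by
    by_contra hne
    have := h_entry ξ 0
    simp [dotF2, hne, Complex.I_ne_zero] at this
  obtain rfl : ε = ε' := by
    apply I_pow_val_injective
    simpa [dotF2] using h_entry ξ 0
  obtain rfl : ζ = ζ' := by
    ext1 t
    apply neg_one_pow_val_injective
    simpa [dotF2_eVec, Complex.I_ne_zero] using h_entry (eVec t + ξ) (eVec t)
  rfl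

lemma pauliMat_phase {n : ℕ} (ε : ZMod 4) :
    pauliMat ((ε, 0, 0) : GG n) = Complex.I ^ ε.val • (1 : PMat n) := by
  ext u v
  simp [pauliMat, PauliOp, dotF2, Matrix.one_apply]

/-- The tableau of the identity: the phase-space elements of the generators. -/
def idTableau (n : ℕ) (i : Fin (2 * n + 1)) : GG n :=
  if _h0 : i.val = 0 then (1, 0, 0)
  else if h1 : i.val ≤ n then (0, eVec ⟨i.val - 1, by have := i.isLt; omega⟩, 0)
  else (0, 0, eVec ⟨i.val - 1 - n, by have := i.isLt; omega⟩)

lemma pauliMat_idTableau {n : ℕ} (i : Fin (2 * n + 1)) :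
    pauliMat (idTableau n i) = gens n i := by
  unfold idTableau gens
  split_ifs
  · rw [pauliMat_phase, ZMod.val_one'' (by decide), pow_one]
  · rfl
  · rfl

lemma foldl_gop_eq_add_sum {n : ℕ} (l : List (GG n)) (a : GG n)
    (hl : (a :: l).Pairwise fun p q => dotF2 p.2.2 q.2.1 = 0) :
    l.foldl gop a = a + l.sum := by
  induction l generalizing a with
  | nil => simp
  | cons x l ih =>
    rw [List.pairwise_cons, List.pairwise_cons] at hl
    obtain ⟨ha, hx, hl⟩ := hl
    have hgop : gop a x = a + x := by
      simp [gop, ha x, lift24, Prod.ext_iff]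
    rw [List.foldl_cons, hgop, ih, List.sum_cons, add_assoc]
    refine List.pairwise_cons.mpr ⟨fun y hy => ?_, hl⟩
    have h₁ := ha y (List.mem_cons_of_mem x hy)
    have h₂ := hx y hy
    simp only [dotF2_eq_dotProduct] at h₁ h₂ ⊢
    simp [add_dotProduct, h₁, h₂]

lemma sum_bitOf_idTableau {n : ℕ} (ϱ : GG n) :
    ∑ i : Fin (2 * n), (if bitOf ϱ i = 1 then idTableau n i.succ else 0) = (0, ϱ.2) := by
  have h_bit : ∀ x : ZMod 2, (if x = 1 then (1 : ZMod 2) else 0) = x := by decide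
  refine Prod.ext ?_ (Prod.ext ?_ ?_)
  · rw [Prod.fst_sum]
    refine Finset.sum_eq_zero fun i _ => ?_
    unfold idTableau
    split_ifs <;> simp_all
  · ext j
    rw [Prod.snd_sum, Prod.fst_sum, Finset.sum_apply,
      Finset.sum_eq_single ⟨j.val, by have := j.isLt; omega⟩]
    · have hj : j.val + 1 ≤ n := j.isLt
      simp only [bitOf, idTableau, Fin.val_succ, j.isLt, hj, dif_pos, Nat.succ_ne_zero, dif_neg,
        not_false_eq_true, Nat.add_sub_cancel]
      conv_rhs => rw [← h_bit (ϱ.2.1 j)]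
      split_ifs <;> simp [eVec]
    · intro i _ hi
      have hi' : i.val ≠ j.val := fun h => hi (Fin.ext h)
      unfold idTableau
      split_ifs
      · simp_all
      · simpa [eVec, Fin.ext_iff] using hi'.symm
      · simp
      · simp
    · simp
  · ext j
    rw [Prod.snd_sum, Prod.snd_sum, Finset.sum_apply,
      Finset.sum_eq_single ⟨n + j.val, by have := j.isLt; omega⟩]
    · have h₁ : ¬ n + j.val < n := by omega
      have h₂ : ¬ n + j.val + 1 ≤ n := by omega
      simp only [bitOf, idTableau, Fin.val_succ, h₁, h₂, Nat.succ_ne_zero, dif_neg,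
        not_false_eq_true, Nat.add_sub_cancel, Nat.add_sub_cancel_left]
      conv_rhs => rw [← h_bit (ϱ.2.2 j)]
      split_ifs <;> simp [eVec]
    · intro i _ hi
      have hi' : i.val ≠ n + j.val := fun h => hi (Fin.ext h)
      unfold idTableau
      split_ifs with _ _ h₂
      · simp_all
      · simp
      · have : j.val ≠ i.val - n := by
          simp only [Fin.val_succ] at h₂
          omega
        simp [eVec, Fin.ext_iff, this]
      · simp
    · simp

lemma starVecMul_idTableau {n : ℕ} (ϱ : GG n) : starVecMul ϱ (idTableau n) = ϱ := by
  have h_zero : (idTableau n 0).1 = 1 := rfl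
  rw [starVecMul, foldl_gop_eq_add_sum, h_zero]
  · have h_sum := sum_bitOf_idTableau ϱ
    rw [← List.sum_ofFn, List.ofFn_eq_map, List.sum_map_ite] at h_sum
    simp only [List.map_const', List.sum_replicate, smul_zero, add_zero] at h_sum
    rw [h_sum]
    simp [Prod.ext_iff]
  · refine List.pairwise_cons.mpr ⟨fun y _ => by simp [dotF2], List.pairwise_map.mpr ?_⟩
    refine ((List.pairwise_lt_finRange _).imp fun {i j} hij => ?_).filter _
    have hij' : i.val < j.val := hij
    unfold idTableau
    simp only [Fin.val_succ]
    split_ifs <;> first | omega | simp [dotF2]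

lemma pauliMat_foldl_conj {n : ℕ} {U : PMat n} (hU : Uᴴ * U = 1) {ι : Type*}
    {f g : ι → GG n} (hfg : ∀ i, pauliMat (f i) = U * pauliMat (g i) * Uᴴ)
    (l : List ι) {a b : GG n} (hab : pauliMat a = U * pauliMat b * Uᴴ) :
    pauliMat ((l.map f).foldl gop a) = U * pauliMat ((l.map g).foldl gop b) * Uᴴ := by
  induction l generalizing a b with
  | nil => exact hab
  | cons i l ih =>
    refine ih ?_
    rw [← pauliMat_mul, ← pauliMat_mul, hab, hfg i]
    calc U * pauliMat b * Uᴴ * (U * pauliMat (g i) * Uᴴ)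
        = U * pauliMat b * (Uᴴ * U) * pauliMat (g i) * Uᴴ := by simp only [Matrix.mul_assoc]
      _ = U * (pauliMat b * pauliMat (g i)) * Uᴴ := by
        rw [hU, Matrix.mul_one]
        simp only [Matrix.mul_assoc]

/-- Multiplying a phase-space element by a Clifford tableau represents conjugation. -/
lemma pauliMat_starVecMul {n : ℕ} {U : PMat n} (hU : U * Uᴴ = 1) (hU' : Uᴴ * U = 1)
    {M : Fin (2 * n + 1) → GG n} (hM : IsCliffordTableau U M) (ϱ : GG n) :
    pauliMat (starVecMul ϱ M) = U * pauliMat ϱ * Uᴴ := by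
  have hM_row (i) : pauliMat (M i) = U * pauliMat (idTableau n i) * Uᴴ := by
    rw [pauliMat_idTableau]
    exact hM i
  have h_phase (ε : ZMod 4) :
      pauliMat ((ε, 0, 0) : GG n) = U * pauliMat ((ε, 0, 0) : GG n) * Uᴴ := by
    simp [pauliMat_phase, hU]
  have h_zero : M 0 = (1, 0, 0) :=
    pauliMat_injective ((hM_row 0).trans (h_phase 1).symm)
  conv_rhs => rw [← starVecMul_idTableau ϱ]
  have h_zero' : (idTableau n 0).1 = 1 := rfl
  unfold starVecMul
  rw [h_zero, h_zero']
  exact pauliMat_foldl_conj hU' (f := fun i : Fin (2 * n) => M i.succ)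
    (g := fun i => idTableau n i.succ) (fun i => hM_row i.succ) _ (h_phase _)

/-- for Clifford unitaries C, C′, the Clifford tableau of C′·C is the
row-wise ⊛-product T(C) ⊛ T(C′) (note the reversal of order). -/
theorem stmt16 (n : ℕ) (hn : 1 ≤ n) (C C' : PMat n)
    (hC : IsCliffordUnitary C) (hC' : IsCliffordUnitary C')
    (M M' M'' : Fin (2 * n + 1) → GG n)
    (hM : IsCliffordTableau C M) (hM' : IsCliffordTableau C' M')
    (hM'' : IsCliffordTableau (C' * C) M'') :
    M'' = fun i => starVecMul (M i) M' := by
  funext i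
  apply pauliMat_injective
  rw [pauliMat_starVecMul hC'.1 hC'.2.1 hM']
  have h : pauliMat (M i) = C * gens n i * Cᴴ := hM i
  have h'' : pauliMat (M'' i) = C' * C * gens n i * (C' * C)ᴴ := hM'' i
  rw [h, h'', Matrix.conjTranspose_mul]
  simp only [Matrix.mul_assoc]
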